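/- arXiv:1201.0554 — 4 statements merged into one kernel-verified Lean document; each statement's English description precedes it below -/
import Mathlib

section
/- R(K₃+e, K₃+e, K₄−e) = R(K₃, K₃, K₄−e). That is, the 3-color Ramsey number is unchanged when the triangle in the first two colors is replaced by the paw graph K₃+e. -/
open SimpleGraph

/-- `G` contains a subgraph isomorphic to `H`:
there is an injective map from the vertices of `H` to those of `G` preserving adjacency. -/
def Contains {V W : Type*} (G : SimpleGraph V) (H : SimpleGraph W) : Prop :=
  ∃ f : W → V, Function.Injective f ∧ ∀ ⦃a b : W⦄, H.Adj a b → G.Adj (f a) (f b)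

/-- The triangle `K₃`. -/
def triangle : SimpleGraph (Fin 3) := ⊤

/-- The paw graph `K₃ + e`: a triangle `{0, 1, 2}` with a pendant edge `{2, 3}`. -/
def paw : SimpleGraph (Fin 4) :=
  SimpleGraph.fromEdgeSet {s(0, 1), s(0, 2), s(1, 2), s(2, 3)}

/-- `J₄ = K₄ - e`, the complete graph on 4 vertices with one edge deleted. -/
def J4 : SimpleGraph (Fin 4) := (⊤ : SimpleGraph (Fin 4)).deleteEdges {s(0, 1)}

/-- The graph formed by the edges of color `i` in the edge coloring `c` of `K_n`. -/
def colorClass {n m : ℕ} (c : Sym2 (Fin n) → Fin m) (i : Fin m) : SimpleGraph (Fin n) :=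
  SimpleGraph.fromEdgeSet {e | c e = i}

/-- A `(G1, G2, G3; n)`-coloring: a 3-coloring of the edges of `K_n` such that
color `i` contains no subgraph isomorphic to `Gi`. -/
def GoodColoring3 {a b d : ℕ} (G1 : SimpleGraph (Fin a)) (G2 : SimpleGraph (Fin b))
    (G3 : SimpleGraph (Fin d)) (n : ℕ) : Prop :=
  ∃ c : Sym2 (Fin n) → Fin 3,
    ¬ Contains (colorClass c 0) G1 ∧ ¬ Contains (colorClass c 1) G2 ∧
      ¬ Contains (colorClass c 2) G3

/-- The 3-color Ramsey number `R(G1, G2, G3)`: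
the least `n` such that no `(G1, G2, G3; n)`-coloring exists. -/
noncomputable def Ramsey3 {a b d : ℕ} (G1 : SimpleGraph (Fin a)) (G2 : SimpleGraph (Fin b))
    (G3 : SimpleGraph (Fin d)) : ℕ :=
  sInf {n : ℕ | ¬ GoodColoring3 G1 G2 G3 n}

/-- In `G`, every neighbour of a vertex of a triangle lies in that triangle. -/
def PawFree {V : Type*} (G : SimpleGraph V) : Prop :=
  ∀ ⦃x y z w : V⦄, G.Adj x y → G.Adj x z → G.Adj y z → G.Adj x w → w = y ∨ w = z

/-- In `G`, two adjacent vertices have at most one common neighbour. -/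
def DiamondFree {V : Type*} (G : SimpleGraph V) : Prop :=
  ∀ ⦃x y z w : V⦄, G.Adj x y → G.Adj x z → G.Adj y z → G.Adj x w → G.Adj y w → w = z

section Lemmas

variable {V : Type*} {G₀ G₁ G₂ : SimpleGraph V}

theorem exists_four_of_card {s : Finset V} (h : 4 ≤ s.card) :
    ∃ x ∈ s, ∃ y ∈ s, ∃ z ∈ s, ∃ w ∈ s,
      x ≠ y ∧ x ≠ z ∧ x ≠ w ∧ y ≠ z ∧ y ≠ w ∧ z ≠ w := by
  classical
  obtain ⟨x, hx⟩ := Finset.card_pos.1 (show 0 < s.card by omega)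
  obtain ⟨y, hy, z, hz, w, hw, h1, h2, h3⟩ := Finset.two_lt_card.1
    (show 2 < (s.erase x).card by rw [Finset.card_erase_of_mem hx]; omega)
  simp only [Finset.mem_erase] at hy hz hw
  exact ⟨x, hx, y, hy.2, z, hz.2, w, hw.2, hy.1.symm, hz.1.symm, hw.1.symm, h1, h2, h3⟩

theorem perfect_matching_of_four (h₀ : PawFree G₀) {Z : Finset V}
    (cov : ∀ x ∈ Z, ∀ y ∈ Z, x ≠ y → G₀.Adj x y ∨ G₂.Adj x y)
    (mat : ∀ x ∈ Z, ∀ y ∈ Z, ∀ z ∈ Z, G₂.Adj x y → G₂.Adj x z → y = z)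
    {x y z w : V} (hx : x ∈ Z) (hy : y ∈ Z) (hz : z ∈ Z) (hw : w ∈ Z)
    (hxy : x ≠ y) (hxz : x ≠ z) (hxw : x ≠ w) (hyz : y ≠ z) (hyw : y ≠ w) (hzw : z ≠ w) :
    (G₂.Adj x y ∧ G₂.Adj z w) ∨ (G₂.Adj x z ∧ G₂.Adj y w) ∨ (G₂.Adj x w ∧ G₂.Adj y z) := by
  have := cov x hx y hy hxy
  have := cov x hx z hz hxz
  have := cov x hx w hw hxw
  have := cov y hy z hz hyz
  have := cov y hy w hw hyw
  have := cov z hz w hw hzw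
  have := mat x hx
  have := mat y hy
  have := mat z hz
  have := mat w hw
  have := G₀.adj_comm
  have := G₂.adj_comm
  unfold PawFree at h₀
  clear cov mat
  grind

theorem card_le_four (h₀ : PawFree G₀) {Z : Finset V}
    (cov : ∀ x ∈ Z, ∀ y ∈ Z, x ≠ y → G₀.Adj x y ∨ G₂.Adj x y)
    (mat : ∀ x ∈ Z, ∀ y ∈ Z, ∀ z ∈ Z, G₂.Adj x y → G₂.Adj x z → y = z) :
    Z.card ≤ 4 := by
  classical
  by_contra! h
  obtain ⟨t, ht⟩ := Finset.card_pos.1 (show 0 < Z.card by omega)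
  obtain ⟨x, hx, y, hy, z, hz, w, hw, hxy, hxz, hxw, hyz, hyw, hzw⟩ := exists_four_of_card
    (show 4 ≤ (Z.erase t).card by rw [Finset.card_erase_of_mem ht]; omega)
  simp only [Finset.mem_erase] at hx hy hz hw
  have key := perfect_matching_of_four h₀ cov mat hx.2 hy.2 hz.2 hw.2 hxy hxz hxw hyz hyw hzw
  have key' := perfect_matching_of_four h₀ cov mat hx.2 hy.2 hz.2 ht hxy hxz hx.1 hyz hy.1 hz.1
  have := mat x hx.2
  have := mat y hy.2
  have := mat z hz.2
  clear cov mat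
  grind

theorem false_of_path (h₀ : PawFree G₀) (h₁ : PawFree G₁) {u v w : V} (huv : G₀.Adj u v)
    (hvw : G₀.Adj v w) (huw : u ≠ w) {Y : Finset V} (hY : 4 ≤ Y.card)
    (hu : u ∉ Y) (hw : w ∉ Y)
    (cov : ∀ x ∈ Y, ∀ y ∈ Y, x ≠ y → G₀.Adj x y ∨ G₁.Adj x y)
    (covu : ∀ x ∈ Y, G₀.Adj u x ∨ G₁.Adj u x)
    (covv : ∀ x ∈ Y, G₀.Adj v x ∨ G₁.Adj v x)
    (covw : ∀ x ∈ Y, G₀.Adj w x ∨ G₁.Adj w x) : False := by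
  have c₀ := G₀.adj_comm
  have c₁ := G₁.adj_comm
  have split : ∀ x ∈ Y, G₁.Adj v x ∨ (G₀.Adj v x ∧ G₁.Adj u x ∧ G₁.Adj w x) := by
    intro x hx
    have := @h₀ v u x w
    have := @h₀ v w x u
    grind
  have ends : ∀ x ∈ Y, ∀ y ∈ Y, x ≠ y → G₁.Adj u x → G₁.Adj w x → G₁.Adj u y → G₀.Adj x y := by
    intro x hx y hy
    have := @h₁ x u y w
    grind
  have uniq : ∀ x ∈ Y, ∀ y ∈ Y, x ≠ y → ¬ G₁.Adj v x → ¬ G₁.Adj v y → False := by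
    intro x hx y hy
    have := @h₀ v x y u
    grind
  have three : ∀ x ∈ Y, ∀ y ∈ Y, ∀ z ∈ Y, ∀ t ∈ Y, x ≠ y → x ≠ z → x ≠ t → y ≠ z → y ≠ t →
      z ≠ t → G₁.Adj v x → G₁.Adj v y → G₁.Adj v z → False := by
    intro x hx y hy z hz t ht hxy hxz hxt hyz hyt hzt ax ay az
    have e₁ : G₀.Adj x y := (cov x hx y hy hxy).resolve_right fun h => by
      have := @h₁ v x y z
      grind
    have e₂ : G₀.Adj x z := (cov x hx z hz hxz).resolve_right fun h => by
      have := @h₁ v x z y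
      grind
    have e₃ : G₀.Adj y z := (cov y hy z hz hyz).resolve_right fun h => by
      have := @h₁ v y z x
      grind
    have iso : ∀ s, G₀.Adj x s → s = y ∨ s = z := fun s hs => h₀ e₁ e₂ e₃ hs
    have := iso u
    have := iso w
    have := iso t
    have := @h₁ v x t y
    have := split t ht
    grind
  obtain ⟨x, hx, y, hy, z, hz, t, ht, hxy, hxz, hxt, hyz, hyt, hzt⟩ := exists_four_of_card hY
  have := uniq x hx y hy
  have := uniq x hx z hz
  have := uniq x hx t ht
  have := uniq y hy z hz
  have := uniq y hy t ht
  have := uniq z hz t ht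
  have := three x hx y hy z hz t ht
  have := three x hx y hy t ht z hz
  have := three x hx z hz t ht y hy
  have := three y hy z hz t ht x hx
  clear uniq three ends split cov
  grind

theorem exists_triangle_of_six {Y : Finset V} (hY : 6 ≤ Y.card)
    (cov : ∀ x ∈ Y, ∀ y ∈ Y, x ≠ y → G₀.Adj x y ∨ G₁.Adj x y) :
    (∃ x ∈ Y, ∃ y ∈ Y, ∃ z ∈ Y, G₀.Adj x y ∧ G₀.Adj x z ∧ G₀.Adj y z) ∨
    (∃ x ∈ Y, ∃ y ∈ Y, ∃ z ∈ Y, G₁.Adj x y ∧ G₁.Adj x z ∧ G₁.Adj y z) := by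
  classical
  obtain ⟨v, hv⟩ := Finset.card_pos.1 (show 0 < Y.card by omega)
  have hc := Finset.card_filter_add_card_filter_not (s := Y.erase v) (fun x => G₀.Adj v x)
  rw [Finset.card_erase_of_mem hv] at hc
  rcases (by omega : 2 < ((Y.erase v).filter fun x => G₀.Adj v x).card ∨
    2 < ((Y.erase v).filter fun x => ¬ G₀.Adj v x).card) with h | h
  all_goals
    obtain ⟨x, hx, y, hy, z, hz, hxy, hxz, hyz⟩ := Finset.two_lt_card.1 h
    simp only [Finset.mem_filter, Finset.mem_erase] at hx hy hz
    have := cov x hx.1.2 y hy.1.2 hxy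
    have := cov x hx.1.2 z hz.1.2 hxz
    have := cov y hy.1.2 z hz.1.2 hyz
    have := cov v hv x hx.1.2
    have := cov v hv y hy.1.2
    have := cov v hv z hz.1.2
    clear cov
    grind

theorem card_le_five_of_triangle (h₀ : PawFree G₀) (h₁ : PawFree G₁) {Y : Finset V} {v : V}
    (hv : v ∉ Y) (cov : ∀ x ∈ Y, ∀ y ∈ Y, x ≠ y → G₀.Adj x y ∨ G₁.Adj x y)
    (uniq : ∀ x ∈ Y, ∀ y ∈ Y, ¬ (G₀.Adj v x ∨ G₁.Adj v x) → ¬ (G₀.Adj v y ∨ G₁.Adj v y) → x = y)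
    {x y z : V} (hx : x ∈ Y) (hy : y ∈ Y) (hz : z ∈ Y)
    (hxy : G₀.Adj x y) (hxz : G₀.Adj x z) (hyz : G₀.Adj y z) : Y.card ≤ 5 := by
  classical
  by_contra! h
  have h3 : 2 < (Y \ {x, y, z}).card := by
    have := Finset.le_card_sdiff {x, y, z} Y
    have := Finset.card_le_three (a := x) (b := y) (c := z)
    omega
  obtain ⟨p, hp, q, hq, r, hr, hpq, hpr, hqr⟩ := Finset.two_lt_card.1 h3
  simp only [Finset.mem_sdiff, Finset.mem_insert, Finset.mem_singleton, not_or] at hp hq hr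
  have isox : ∀ s, G₀.Adj x s → s = y ∨ s = z := fun s hs => h₀ hxy hxz hyz hs
  have isoy : ∀ s, G₀.Adj y s → s = x ∨ s = z := fun s hs => h₀ hxy.symm hyz hxz hs
  have isoz : ∀ s, G₀.Adj z s → s = x ∨ s = y := fun s hs => h₀ hxz.symm hyz.symm hxy hs
  have cross : ∀ s ∈ Y, s ≠ x → s ≠ y → s ≠ z → G₁.Adj x s ∧ G₁.Adj y s ∧ G₁.Adj z s := by
    intro s hs
    have := cov x hx s hs
    have := cov y hy s hs
    have := cov z hz s hs
    have := isox s
    have := isoy s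
    have := isoz s
    grind
  obtain ⟨xp, yp, zp⟩ := cross p hp.1 hp.2.1 hp.2.2.1 hp.2.2.2
  obtain ⟨xq, yq, zq⟩ := cross q hq.1 hq.2.1 hq.2.2.1 hq.2.2.2
  obtain ⟨xr, yr, zr⟩ := cross r hr.1 hr.2.1 hr.2.2.1 hr.2.2.2
  have e₁ : G₀.Adj p q := (cov p hp.1 q hq.1 hpq).resolve_right fun h => by
    have := h₁ xp xq h xr
    grind
  have e₂ : G₀.Adj p r := (cov p hp.1 r hr.1 hpr).resolve_right fun h => by
    have := h₁ xp xr h xq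
    grind
  have e₃ : G₀.Adj q r := (cov q hq.1 r hr.1 hqr).resolve_right fun h => by
    have := h₁ xq xr h xp
    grind
  have nx : ¬ G₀.Adj v x := fun h => by have := isox v h.symm; grind
  have ny : ¬ G₀.Adj v y := fun h => by have := isoy v h.symm; grind
  have np : ¬ G₀.Adj v p := fun h => by have := h₀ e₁ e₂ e₃ h.symm; grind
  have nq : ¬ G₀.Adj v q := fun h => by have := h₀ e₁.symm e₃ e₂ h.symm; grind
  have no : ∀ s ∈ Y, ∀ t ∈ Y, ∀ a ∈ Y, a ≠ s → G₁.Adj s t → G₁.Adj t a →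
      ¬ (G₁.Adj v s ∧ G₁.Adj v t) := by
    rintro s hs t ht a ha has hst hta ⟨h, h'⟩
    have := h₁ hst.symm h'.symm h.symm hta
    grind
  have := no x hx p hp.1 y hy hxy.ne' xp yp.symm
  have := no y hy p hp.1 x hx hxy.ne yp xp.symm
  have := no x hx q hq.1 y hy hxy.ne' xq yq.symm
  have := no y hy q hq.1 x hx hxy.ne yq xq.symm
  have := uniq x hx y hy
  have := uniq x hx p hp.1
  have := uniq x hx q hq.1
  have := uniq y hy p hp.1
  have := uniq y hy q hq.1
  have := uniq p hp.1 q hq.1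
  have := hxy.ne
  clear no uniq cov cross isox isoy isoz h₀ h₁
  grind

theorem card_le_five (h₀ : PawFree G₀) (h₁ : PawFree G₁) {Y : Finset V} {v : V}
    (hv : v ∉ Y) (cov : ∀ x ∈ Y, ∀ y ∈ Y, x ≠ y → G₀.Adj x y ∨ G₁.Adj x y)
    (uniq : ∀ x ∈ Y, ∀ y ∈ Y, ¬ (G₀.Adj v x ∨ G₁.Adj v x) → ¬ (G₀.Adj v y ∨ G₁.Adj v y) → x = y) :
    Y.card ≤ 5 := by
  by_contra! h
  rcases exists_triangle_of_six h cov with ⟨x, hx, y, hy, z, hz, e₁, e₂, e₃⟩ |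
    ⟨x, hx, y, hy, z, hz, e₁, e₂, e₃⟩
  · exact h.not_ge (card_le_five_of_triangle h₀ h₁ hv cov uniq hx hy hz e₁ e₂ e₃)
  · refine h.not_ge (card_le_five_of_triangle h₁ h₀ hv (fun x hx y hy h => (cov x hx y hy h).symm)
      (fun x hx y hy h h' => uniq x hx y hy (mt Or.symm h) (mt Or.symm h')) hx hy hz e₁ e₂ e₃)

theorem card_le_six (h₀ : PawFree G₀) (h₂ : DiamondFree G₂) {S : Finset V}
    (cov : ∀ x ∈ S, ∀ y ∈ S, x ≠ y → G₀.Adj x y ∨ G₂.Adj x y) : S.card ≤ 6 := by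
  classical
  by_contra! h
  have c₀ := G₀.adj_comm
  have c₂ := G₂.adj_comm
  obtain ⟨v, hv⟩ := Finset.card_pos.1 (show 0 < S.card by omega)
  set A := (S.erase v).filter fun x => G₂.Adj v x with hA
  set B := (S.erase v).filter fun x => ¬ G₂.Adj v x with hB
  have hc : A.card + B.card = (S.erase v).card :=
    Finset.card_filter_add_card_filter_not (s := S.erase v) (fun x => G₂.Adj v x)
  rw [Finset.card_erase_of_mem hv] at hc
  have memA : ∀ x ∈ A, x ∈ S ∧ G₂.Adj v x := by
    simp +contextual [hA]
  have memB : ∀ x ∈ B, x ∈ S ∧ G₀.Adj v x ∧ ¬ G₂.Adj v x := by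
    intro x hx
    simp only [hB, Finset.mem_filter, Finset.mem_erase] at hx
    have := cov v hv x hx.1.2
    grind
  have matA : ∀ x ∈ A, ∀ y ∈ A, ∀ z ∈ A, G₂.Adj x y → G₂.Adj x z → y = z := by
    intro x hx y hy z hz hxy hxz
    exact (h₂ (memA x hx).2 (memA y hy).2 hxy (memA z hz).2 hxz).symm
  have covA : ∀ x ∈ A, ∀ y ∈ A, x ≠ y → G₀.Adj x y ∨ G₂.Adj x y := fun x hx y hy =>
    cov x (memA x hx).1 y (memA y hy).1
  have cliqueB : 3 ≤ B.card → ∀ x ∈ B, ∀ y ∈ B, x ≠ y → G₂.Adj x y := by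
    intro h3 x hx y hy hxy
    refine (cov x (memB x hx).1 y (memB y hy).1 hxy).resolve_left fun hadj => ?_
    obtain ⟨z, hz, hzn⟩ := Finset.exists_mem_notMem_of_card_lt_card
      (show ({x, y} : Finset V).card < B.card by rw [Finset.card_pair hxy]; omega)
    have := h₀ (memB x hx).2.1 (memB y hy).2.1 hadj (memB z hz).2.1
    simp at hzn
    grind
  have hA4 := card_le_four h₀ covA matA
  have crossAB : ∀ p ∈ S, p ∉ A → p ≠ v → ∀ x ∈ A, ∀ y ∈ A, G₂.Adj x y → G₀.Adj p x ∨ G₀.Adj p y := by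
    intro p hp hpA hpv x hx y hy hxy
    have := cov p hp x (memA x hx).1
    have := cov p hp y (memA y hy).1
    have := @h₂ x y v p
    have := memA x hx
    have := memA y hy
    grind
  rcases (by omega : 4 ≤ B.card ∨ 4 = A.card ∧ 2 ≤ B.card ∨ A.card = 3 ∧ B.card = 3) with
    h4 | ⟨h4, h2⟩ | ⟨hA3, hB3⟩
  · obtain ⟨x, hx, y, hy, z, hz, w, hw, hxy, hxz, hxw, hyz, hyw, hzw⟩ := exists_four_of_card h4
    have cl := cliqueB (by omega)
    exact hzw (h₂ (cl x hx y hy hxy) (cl x hx z hz hxz) (cl y hy z hz hyz) (cl x hx w hw hxw)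
      (cl y hy w hw hyw)).symm
  · obtain ⟨p, hp⟩ := Finset.card_pos.1 (show 0 < B.card by omega)
    have hpA : p ∉ A := fun h => (memB p hp).2.2 (memA p h).2
    have cross := crossAB p (memB p hp).1 hpA (memB p hp).2.1.ne'
    have step : ∀ x ∈ A, ∀ y ∈ A, ∀ z ∈ A, ∀ w ∈ A, x ≠ z → x ≠ w → y ≠ z → y ≠ w →
        G₂.Adj x y → G₂.Adj z w → G₀.Adj p x → G₀.Adj p z → False := by
      intro x hx y hy z hz w hw hxz hxw hyz hyw exy ezw px pz
      have exz : G₀.Adj x z := (covA x hx z hz hxz).resolve_right fun h =>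
        hyz (matA x hx y hy z hz exy h)
      have eyz : G₀.Adj z y := (covA z hz y hy hyz.symm).resolve_right fun h =>
        hyw (matA z hz y hy w hw h ezw)
      have := h₀ exz.symm pz.symm px.symm eyz
      have := exy.ne
      grind
    have step' : ∀ x ∈ A, ∀ y ∈ A, ∀ z ∈ A, ∀ w ∈ A, x ≠ z → x ≠ w → y ≠ z → y ≠ w →
        G₂.Adj x y → G₂.Adj z w → False := by
      intro x hx y hy z hz w hw hxz hxw hyz hyw exy ezw
      rcases cross x hx y hy exy with hpx | hpx <;> rcases cross z hz w hw ezw with hpz | hpz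
      · exact step x hx y hy z hz w hw hxz hxw hyz hyw exy ezw hpx hpz
      · exact step x hx y hy w hw z hz hxw hxz hyw hyz exy ezw.symm hpx hpz
      · exact step y hy x hx z hz w hw hyz hyw hxz hxw exy.symm ezw hpx hpz
      · exact step y hy x hx w hw z hz hyw hyz hxw hxz exy.symm ezw.symm hpx hpz
    obtain ⟨x, hx, y, hy, z, hz, w, hw, hxy, hxz, hxw, hyz, hyw, hzw⟩ := exists_four_of_card h4.le
    rcases perfect_matching_of_four h₀ covA matA hx hy hz hw hxy hxz hxw hyz hyw hzw with
      ⟨e, e'⟩ | ⟨e, e'⟩ | ⟨e, e'⟩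
    · exact step' x hx y hy z hz w hw hxz hxw hyz hyw e e'
    · exact step' x hx z hz y hy w hw hxy hxw hyz.symm hzw e e'
    · exact step' x hx w hw y hy z hz hxy hxz hyw.symm hzw.symm e e'
  · obtain ⟨p, hp, q, hq, r, hr, hpq, hpr, hqr⟩ := Finset.two_lt_card.1 (show 2 < B.card by omega)
    obtain ⟨x, hx, y, hy, z, hz, hxy, hxz, hyz⟩ := Finset.two_lt_card.1 (show 2 < A.card by omega)
    have cl := cliqueB (by omega)
    have epq := cl p hp q hq hpq
    have epr := cl p hp r hr hpr
    have eqr := cl q hq r hr hqr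
    have disj : ∀ x ∈ A, x ∉ B := fun x hx hx' => (memB x hx').2.2 (memA x hx).2
    have two : ∀ x ∈ A, ∀ p ∈ B, ∀ q ∈ B, ∀ r ∈ B, p ≠ q → p ≠ r → q ≠ r →
        G₀.Adj x p ∨ G₀.Adj x q := by
      intro x hx p hp q hq r hr hpq hpr hqr
      by_contra! h
      have hxB := disj x hx
      have e₁ := (cov x (memA x hx).1 p (memB p hp).1 (by grind)).resolve_left h.1
      have e₂ := (cov x (memA x hx).1 q (memB q hq).1 (by grind)).resolve_left h.2
      have := h₂ (cl p hp q hq hpq) e₁.symm e₂.symm (cl p hp r hr hpr) (cl q hq r hr hqr)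
      grind
    have no : ∀ x ∈ A, ∀ y ∈ A, ∀ z ∈ A, x ≠ z → ¬ (G₀.Adj y x ∧ G₀.Adj y z) := by
      rintro x hx y hy z hz hxz ⟨e, e'⟩
      have common : ∀ p ∈ B, ¬ (G₀.Adj x p ∧ G₀.Adj y p) := by
        rintro p hp ⟨h, h'⟩
        have := h₀ e h' h e'
        have := disj z hz
        grind
      have := two x hx p hp q hq r hr
      have := two x hx p hp r hr q hq
      have := two x hx q hq r hr p hp
      have := two y hy p hp q hq r hr
      have := two y hy p hp r hr q hq
      have := two y hy q hq r hr p hp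
      have := common p hp
      have := common q hq
      have := common r hr
      clear two common cl crossAB cov covA matA memA memB h₀ h₂
      grind
    have := no x hx y hy z hz hxz
    have := no y hy x hx z hz hyz
    have := no x hx z hz y hy hxy
    have := matA x hx y hy z hz
    have := matA y hy x hx z hz
    have := matA z hz x hx y hy
    have := covA x hx y hy hxy
    have := covA x hx z hz hxz
    have := covA y hy z hz hyz
    clear two no cl crossAB cov covA matA memA memB h₀ h₂
    grind

theorem card_le_six_of_adj (h₀ : PawFree G₀) (h₁ : PawFree G₁) (h₂ : DiamondFree G₂)
    (cov : ∀ x y, x ≠ y → G₀.Adj x y ∨ G₁.Adj x y ∨ G₂.Adj x y) {b : V} {P : Finset V}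
    (hP : ∀ x ∈ P, G₁.Adj b x) : P.card ≤ 6 := by
  classical
  by_cases h : ∃ x ∈ P, ∃ y ∈ P, G₁.Adj x y
  · obtain ⟨x, hx, y, hy, hxy⟩ := h
    have hsub : P ⊆ {x, y} := by
      intro z hz
      simpa using h₁ (hP x hx) (hP y hy) hxy (hP z hz)
    have := Finset.card_le_card hsub
    have := Finset.card_le_two (a := x) (b := y)
    omega
  · push Not at h
    refine card_le_six h₀ h₂ fun x hx y hy hxy => ?_
    have := h x hx y hy
    have := cov x y hxy
    tauto

theorem false_of_triangle (h₀ : PawFree G₀) (h₁ : PawFree G₁) {u v w : V} (huv : G₀.Adj u v)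
    (huw : G₀.Adj u w) (hvw : G₀.Adj v w) {Y : Finset V} (hY : 4 ≤ Y.card)
    (hu : u ∉ Y) (hv : v ∉ Y) (hw : w ∉ Y)
    (cov : ∀ x ∈ Y, ∀ y ∈ Y, x ≠ y → G₀.Adj x y ∨ G₁.Adj x y)
    (covuv : ∀ x ∈ Y, (G₀.Adj u x ∨ G₁.Adj u x) ∨ (G₀.Adj v x ∨ G₁.Adj v x))
    (covuw : ∀ x ∈ Y, (G₀.Adj u x ∨ G₁.Adj u x) ∨ (G₀.Adj w x ∨ G₁.Adj w x))
    (covvw : ∀ x ∈ Y, (G₀.Adj v x ∨ G₁.Adj v x) ∨ (G₀.Adj w x ∨ G₁.Adj w x)) : False := by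
  have nu : ∀ x ∈ Y, ¬ G₀.Adj u x := fun x hx h => by
    have := h₀ huv huw hvw h
    grind
  have nv : ∀ x ∈ Y, ¬ G₀.Adj v x := fun x hx h => by
    have := h₀ huv.symm hvw huw h
    grind
  have nw : ∀ x ∈ Y, ¬ G₀.Adj w x := fun x hx h => by
    have := h₀ huw.symm hvw.symm huv h
    grind
  have no : ∀ s t, s ≠ t → t ∉ Y → ∀ x ∈ Y, ∀ y ∈ Y, G₁.Adj x y →
      G₁.Adj s x → G₁.Adj s y → ¬ G₁.Adj t x := by
    intro s t hst ht x hx y hy hxy hsx hsy htx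
    have := h₁ hsx.symm hxy hsy htx.symm
    grind
  have clique : ∀ x ∈ Y, ∀ y ∈ Y, x ≠ y → G₀.Adj x y := by
    intro x hx y hy hxy
    refine (cov x hx y hy hxy).resolve_right fun h => ?_
    have := no u v huv.ne hv x hx y hy h
    have := no u w huw.ne hw x hx y hy h
    have := no v u huv.ne' hu x hx y hy h
    have := no v w hvw.ne hw x hx y hy h
    have := no w u huw.ne' hu x hx y hy h
    have := no w v hvw.ne' hv x hx y hy h
    have := no u v huv.ne hv y hy x hx h.symm
    have := no u w huw.ne hw y hy x hx h.symm
    have := no v u huv.ne' hu y hy x hx h.symm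
    have := no v w hvw.ne hw y hy x hx h.symm
    have := no w u huw.ne' hu y hy x hx h.symm
    have := no w v hvw.ne' hv y hy x hx h.symm
    have := covuv x hx
    have := covuw x hx
    have := covvw x hx
    have := covuv y hy
    have := covuw y hy
    have := covvw y hy
    have := nu x hx
    have := nv x hx
    have := nw x hx
    have := nu y hy
    have := nv y hy
    have := nw y hy
    clear no nu nv nw covuv covuw covvw cov h₀ h₁
    grind
  obtain ⟨x, hx, y, hy, z, hz, t, ht, hxy, hxz, hxt, hyz, hyt, hzt⟩ := exists_four_of_card hY
  have := h₀ (clique x hx y hy hxy) (clique x hx z hz hxz) (clique y hy z hz hyz)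
    (clique x hx t ht hxt)
  grind

theorem not_triangle_of_card [Fintype V] (hV : 17 ≤ Fintype.card V)
    (h₀ : PawFree G₀) (h₁ : PawFree G₁) (h₂ : DiamondFree G₂)
    (cov : ∀ x y, x ≠ y → G₀.Adj x y ∨ G₁.Adj x y ∨ G₂.Adj x y) {a b c : V}
    (hab : G₀.Adj a b) (hac : G₀.Adj a c) (hbc : G₀.Adj b c) : False := by
  classical
  set U : Finset V := Finset.univ \ {a, b, c} with hU
  have hUc : 14 ≤ U.card := by
    have hsd := Finset.le_card_sdiff {a, b, c} (Finset.univ : Finset V)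
    rw [← hU, Finset.card_univ] at hsd
    have := Finset.card_le_three (a := a) (b := b) (c := c)
    omega
  have memU : ∀ x ∈ U, (G₁.Adj a x ∨ G₂.Adj a x) ∧ (G₁.Adj b x ∨ G₂.Adj b x) := by
    intro x hx
    simp only [hU, Finset.mem_sdiff, Finset.mem_univ, true_and, Finset.mem_insert,
      Finset.mem_singleton, not_or] at hx
    have := cov a x (Ne.symm hx.1)
    have := cov b x (Ne.symm hx.2.1)
    have := @h₀ a b c x hab hac hbc
    have := @h₀ b a c x hab.symm hbc hac
    tauto
  set N := U.filter fun x => ¬ G₁.Adj b x with hN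
  set Z := N.filter fun x => G₁.Adj a x with hZ
  set Y := N.filter fun x => ¬ G₁.Adj a x with hY
  have hNc : 8 ≤ N.card := by
    have hsum := Finset.card_filter_add_card_filter_not (s := U) (fun x => G₁.Adj b x)
    rw [← hN] at hsum
    have := card_le_six_of_adj (P := U.filter fun x => G₁.Adj b x) (b := b) h₀ h₁ h₂ cov (by simp)
    omega
  have hYZ : Z.card + Y.card = N.card :=
    Finset.card_filter_add_card_filter_not (s := N) (fun x => G₁.Adj a x)
  have memN : ∀ x ∈ N, G₂.Adj b x := by
    intro x hx
    simp only [hN, Finset.mem_filter] at hx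
    have := memU x hx.1
    tauto
  have memZ : ∀ x ∈ Z, x ∈ N ∧ G₁.Adj a x := by simp [hZ]
  have memY : ∀ x ∈ Y, x ∈ N ∧ G₂.Adj a x := by
    intro x hx
    simp only [hY, Finset.mem_filter] at hx
    have hxU : x ∈ U := (Finset.mem_filter.1 hx.1).1
    have := memU x hxU
    tauto
  have disj : ∀ x ∈ Z, x ∉ Y := by
    intro x hx hx'
    exact (Finset.mem_filter.1 hx').2 (Finset.mem_filter.1 hx).2
  have matN : ∀ x ∈ N, ∀ y ∈ N, ∀ z ∈ N, G₂.Adj x y → G₂.Adj x z → y = z := by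
    intro x hx y hy z hz hxy hxz
    exact (h₂ (memN x hx) (memN y hy) hxy (memN z hz) hxz).symm
  have covY : ∀ x ∈ Y, ∀ y ∈ Y, x ≠ y → G₀.Adj x y ∨ G₁.Adj x y := by
    intro x hx y hy hxy
    have : ¬ G₂.Adj x y := fun h =>
      hab.ne' (h₂ h (memY x hx).2.symm (memY y hy).2.symm (memN x (memY x hx).1).symm
        (memN y (memY y hy).1).symm)
    have := cov x y hxy
    tauto
  have uniqN : ∀ v ∈ N, ∀ x ∈ N, ∀ y ∈ N, v ≠ x → v ≠ y → ¬ (G₀.Adj v x ∨ G₁.Adj v x) →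
      ¬ (G₀.Adj v y ∨ G₁.Adj v y) → x = y := by
    intro v hv x hx y hy hvx hvy h h'
    have := cov v x hvx
    have := cov v y hvy
    exact matN v hv x hx y hy (by tauto) (by tauto)
  have hY5 : Z.card ≠ 0 → Y.card ≤ 5 := by
    intro h
    obtain ⟨z, hz⟩ := Finset.card_pos.1 (Nat.pos_of_ne_zero h)
    have hzY := disj z hz
    exact card_le_five h₀ h₁ hzY covY fun x hx y hy =>
      uniqN z (memZ z hz).1 x (memY x hx).1 y (memY y hy).1 (by grind) (by grind)
  have hZ0 : Z.card ≠ 0 := by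
    intro h
    obtain ⟨v, hv⟩ := Finset.card_pos.1 (show 0 < Y.card by omega)
    have hsub : ∀ x ∈ Y.erase v, x ∈ Y := fun x => Finset.mem_of_mem_erase
    have := card_le_five h₀ h₁ (Finset.notMem_erase v Y)
      (fun x hx y hy => covY x (hsub x hx) y (hsub y hy)) fun x hx y hy =>
        uniqN v (memY v hv).1 x (memY x (hsub x hx)).1 y (memY y (hsub y hy)).1
          (Finset.ne_of_mem_erase hx).symm (Finset.ne_of_mem_erase hy).symm
    rw [Finset.card_erase_of_mem hv] at this
    omega
  have hY5 := hY5 hZ0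
  have noZ : ∀ x ∈ Z, ∀ y ∈ Z, ¬ G₁.Adj x y := by
    intro x hx y hy hxy
    have hsub : Z ⊆ {x, y} := by
      intro z hz
      simpa using h₁ (memZ x hx).2 (memZ y hy).2 hxy (memZ z hz).2
    have := Finset.card_le_card hsub
    have := Finset.card_le_two (a := x) (b := y)
    omega
  have covZ : ∀ x ∈ Z, ∀ y ∈ Z, x ≠ y → G₀.Adj x y ∨ G₂.Adj x y := by
    intro x hx y hy hxy
    have := noZ x hx y hy
    have := cov x y hxy
    tauto
  have matZ : ∀ x ∈ Z, ∀ y ∈ Z, ∀ z ∈ Z, G₂.Adj x y → G₂.Adj x z → y = z :=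
    fun x hx y hy z hz => matN x (memZ x hx).1 y (memZ y hy).1 z (memZ z hz).1
  have hZ4 := card_le_four h₀ covZ matZ
  have ne : ∀ x ∈ Z, ∀ y ∈ Y, x ≠ y := by
    rintro x hx _ hy rfl
    exact disj x hx hy
  have matched : ∀ x ∈ Z, ∀ y ∈ Z, G₂.Adj x y → ∀ z ∈ Y, G₀.Adj x z ∨ G₁.Adj x z := by
    intro x hx y hy hxy z hz
    have : ¬ G₂.Adj x z := fun h =>
      ne y hy z hz (matN x (memZ x hx).1 y (memZ y hy).1 z (memY z hz).1 hxy h)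
    have := cov x z (ne x hx z hz)
    tauto
  by_cases hex : ∃ u ∈ Z, ∃ w ∈ Z, G₂.Adj u w
  · obtain ⟨u, hu, w, hw, huw⟩ := hex
    obtain ⟨v, hv, hvn⟩ := Finset.exists_mem_notMem_of_card_lt_card
      (show ({u, w} : Finset V).card < Z.card by rw [Finset.card_pair huw.ne]; omega)
    simp only [Finset.mem_insert, Finset.mem_singleton, not_or] at hvn
    have euv : G₀.Adj u v := (covZ u hu v hv (Ne.symm hvn.1)).resolve_right fun h =>
      hvn.2 (matZ u hu v hv w hw h huw)
    have evw : G₀.Adj v w := (covZ v hv w hw hvn.2).resolve_right fun h =>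
      hvn.1 (matZ w hw v hv u hu h.symm huw.symm)
    have hY' : 4 ≤ (Y.filter fun x => G₀.Adj v x ∨ G₁.Adj v x).card := by
      have hsum := Finset.card_filter_add_card_filter_not (s := Y)
        (fun x => G₀.Adj v x ∨ G₁.Adj v x)
      have hle : (Y.filter fun x => ¬ (G₀.Adj v x ∨ G₁.Adj v x)).card ≤ 1 := by
        refine Finset.card_le_one.2 fun x hx y hy => ?_
        simp only [Finset.mem_filter] at hx hy
        exact uniqN v (memZ v hv).1 x (memY x hx.1).1 y (memY y hy.1).1 (ne v hv x hx.1)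
          (ne v hv y hy.1) hx.2 hy.2
      by_cases h4 : Z.card = 4
      · obtain ⟨t, ht, htn⟩ := Finset.exists_mem_notMem_of_card_lt_card
          (show ({u, v, w} : Finset V).card < Z.card by
            have := Finset.card_le_three (a := u) (b := v) (c := w)
            omega)
        simp only [Finset.mem_insert, Finset.mem_singleton, not_or] at htn
        have hvt : G₂.Adj v t := by
          have hp := perfect_matching_of_four h₀ covZ matZ hu hv hw ht (Ne.symm hvn.1) huw.ne
            (Ne.symm htn.1) hvn.2 (Ne.symm htn.2.1) (Ne.symm htn.2.2)
          have := matZ u hu w hw v hv huw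
          have := matZ u hu w hw t ht huw
          grind
        rw [Finset.filter_true_of_mem (matched v hv t ht hvt)]
        omega
      · omega
    have hsub : ∀ x ∈ Y.filter fun x => G₀.Adj v x ∨ G₁.Adj v x, x ∈ Y :=
      fun x hx => (Finset.mem_filter.1 hx).1
    exact false_of_path h₀ h₁ euv evw huw.ne hY' (fun h => disj u hu (hsub u h))
      (fun h => disj w hw (hsub w h))
      (fun x hx y hy => covY x (hsub x hx) y (hsub y hy))
      (fun x hx => matched u hu w hw huw x (hsub x hx))
      (fun x hx => (Finset.mem_filter.1 hx).2)
      (fun x hx => matched w hw u hu huw.symm x (hsub x hx))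
  · push Not at hex
    have clique : ∀ x ∈ Z, ∀ y ∈ Z, x ≠ y → G₀.Adj x y := fun x hx y hy hxy =>
      (covZ x hx y hy hxy).resolve_right (hex x hx y hy)
    obtain ⟨u, hu, v, hv, w, hw, huv, huw, hvw⟩ := Finset.two_lt_card.1 (show 2 < Z.card by omega)
    have pair : ∀ u ∈ Z, ∀ v ∈ Z, u ≠ v → ∀ x ∈ Y,
        (G₀.Adj u x ∨ G₁.Adj u x) ∨ (G₀.Adj v x ∨ G₁.Adj v x) := by
      intro u hu v hv huv x hx
      by_contra! h
      have h₁' := cov u x (ne u hu x hx)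
      have h₂' := cov v x (ne v hv x hx)
      exact huv (matN x (memY x hx).1 u (memZ u hu).1 v (memZ v hv).1
        (G₂.adj_symm (by tauto)) (G₂.adj_symm (by tauto)))
    exact false_of_triangle h₀ h₁ (clique u hu v hv huv) (clique u hu w hw huw)
      (clique v hv w hw hvw) (show 4 ≤ Y.card by omega) (disj u hu) (disj v hv) (disj w hw) covY
      (pair u hu v hv huv) (pair u hu w hw huw) (pair v hv w hw hvw)
end Lemmas

theorem pawFree_of_not_contains {n : ℕ} {G : SimpleGraph (Fin n)} (h : ¬ Contains G paw) :
    PawFree G := by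
  intro x y z w hxy hxz hyz hxw
  by_contra! hne
  refine h ⟨![y, z, x, w], ?_, ?_⟩
  · have := hxy.ne
    have := hxz.ne
    have := hyz.ne
    have := hxw.ne
    intro i j hij
    fin_cases i <;> fin_cases j <;> simp_all
  · intro i j hij
    have := hxy.symm
    have := hxz.symm
    have := hyz.symm
    have := hxw.symm
    fin_cases i <;> fin_cases j <;> simp_all [paw]

theorem diamondFree_of_not_contains {n : ℕ} {G : SimpleGraph (Fin n)} (h : ¬ Contains G J4) :
    DiamondFree G := by
  intro x y z w hxy hxz hyz hxw hyw
  by_contra! hne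
  refine h ⟨![z, w, x, y], ?_, ?_⟩
  · have := hxy.ne
    have := hxz.ne
    have := hyz.ne
    have := hxw.ne
    have := hyw.ne
    intro i j hij
    fin_cases i <;> fin_cases j <;> simp_all
  · intro i j hij
    have := hxy.symm
    have := hxz.symm
    have := hyz.symm
    have := hxw.symm
    have := hyw.symm
    fin_cases i <;> fin_cases j <;> simp_all [J4]

theorem exists_triangle_of_contains {n : ℕ} {G : SimpleGraph (Fin n)} (h : Contains G triangle) :
    ∃ x y z, G.Adj x y ∧ G.Adj x z ∧ G.Adj y z := by
  obtain ⟨f, -, hf⟩ := h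
  exact ⟨f 0, f 1, f 2, hf (by simp [triangle]), hf (by simp [triangle]), hf (by simp [triangle])⟩

theorem contains_triangle_of_contains_paw {n : ℕ} {G : SimpleGraph (Fin n)}
    (h : Contains G paw) : Contains G triangle := by
  obtain ⟨f, hinj, hf⟩ := h
  refine ⟨f ∘ Fin.castSucc, hinj.comp (Fin.castSucc_injective 3), fun i j hij => hf ?_⟩
  fin_cases i <;> fin_cases j <;> simp_all [paw, triangle]

theorem exists_triangle_of_contains_J4 {n : ℕ} {G : SimpleGraph (Fin n)} (h : Contains G J4) :
    ∃ x y z, G.Adj x y ∧ G.Adj x z ∧ G.Adj y z := by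
  obtain ⟨f, -, hf⟩ := h
  exact ⟨f 0, f 2, f 3, hf (by simp [J4]), hf (by simp [J4]), hf (by simp [J4])⟩

/-- The cubic residue class in the field with 16 elements, whose elements are written in binary
with respect to a root of `X ^ 4 + X + 1`; each class is sum-free. -/
def cubicClass : Fin 16 → Fin 3 := ![0, 0, 1, 1, 2, 2, 2, 1, 0, 2, 0, 1, 0, 1, 2, 0]

theorem cubicClass_sumFree : ∀ x y : Fin 16, x ≠ 0 → y ≠ 0 → x ≠ y →
    cubicClass x = cubicClass y → cubicClass (x ^^^ y) ≠ cubicClass x := by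
  decide

/-- The colouring of the complete graph on `Fin 16` in which the colour of `xy` is
the cubic residue class of the difference of `x` and `y`. -/
def cubicColoring : Sym2 (Fin 16) → Fin 3 :=
  Sym2.lift ⟨fun x y => cubicClass (x ^^^ y), by decide⟩

theorem cubicColoring_triangle : ∀ (x y z : Fin 16), x ≠ y → x ≠ z → y ≠ z →
    cubicColoring s(x, y) = cubicColoring s(x, z) →
    cubicColoring s(y, z) ≠ cubicColoring s(x, y) := by
  intro x y z hxy hxz hyz h
  have hzero : ∀ u v : Fin 16, u ≠ v → u ^^^ v ≠ 0 := by decide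
  have hcancel : ∀ u v w : Fin 16, (u ^^^ v) ^^^ (u ^^^ w) = v ^^^ w := by
    intro u v w
    have val_xor : ∀ a b : Fin 16, (a ^^^ b).val = a.val ^^^ b.val :=
      Fin.xor_val_of_two_pow (w := 4)
    ext
    simp only [val_xor]
    rw [Nat.xor_comm u.val v, Nat.xor_assoc, ← Nat.xor_assoc u.val, Nat.xor_self, Nat.zero_xor]
  have hself : ∀ u : Fin 16, u ^^^ u = 0 := by decide
  have := cubicClass_sumFree (x ^^^ y) (x ^^^ z) (hzero x y hxy) (hzero x z hxz)
    (fun h => hzero y z hyz (by rw [← hcancel x y z, h, hself])) h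
  rwa [hcancel] at this

theorem goodColoring3_triangle_of_le {n : ℕ} (hn : n ≤ 16) :
    GoodColoring3 triangle triangle J4 n := by
  have key : ∀ i : Fin 3, ¬ ∃ x y z, (colorClass
      (fun e => cubicColoring (e.map (Fin.castLE hn)) : Sym2 (Fin n) → Fin 3) i).Adj x y ∧
      (colorClass (fun e => cubicColoring (e.map (Fin.castLE hn))) i).Adj x z ∧
      (colorClass (fun e => cubicColoring (e.map (Fin.castLE hn))) i).Adj y z := by
    rintro i ⟨x, y, z, hxy, hxz, hyz⟩
    simp only [colorClass, SimpleGraph.fromEdgeSet_adj, Set.mem_ofPred_eq, Sym2.map_mk] at *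
    have inj := Fin.castLE_injective hn
    exact cubicColoring_triangle _ _ _ (inj.ne hxy.2) (inj.ne hxz.2) (inj.ne hyz.2)
      (hxy.1.trans hxz.1.symm) (hyz.1.trans hxy.1.symm)
  exact ⟨_, fun h => key 0 (exists_triangle_of_contains h),
    fun h => key 1 (exists_triangle_of_contains h), fun h => key 2 (exists_triangle_of_contains_J4 h)⟩

theorem goodColoring3_paw_iff (n : ℕ) :
    GoodColoring3 paw paw J4 n ↔ GoodColoring3 triangle triangle J4 n := by
  constructor
  · intro h
    rcases le_or_gt n 16 with hn | hn
    · exact goodColoring3_triangle_of_le hn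
    obtain ⟨c, h₀, h₁, h₂⟩ := h
    have cov : ∀ x y, x ≠ y →
        (colorClass c 0).Adj x y ∨ (colorClass c 1).Adj x y ∨ (colorClass c 2).Adj x y := by
      intro x y hxy
      simp only [colorClass, SimpleGraph.fromEdgeSet_adj, Set.mem_ofPred_eq]
      grind
    have hV : 17 ≤ Fintype.card (Fin n) := by rwa [Fintype.card_fin]
    refine ⟨c, fun h => ?_, fun h => ?_, h₂⟩ <;>
      obtain ⟨x, y, z, hxy, hxz, hyz⟩ := exists_triangle_of_contains h
    · exact not_triangle_of_card hV (pawFree_of_not_contains h₀) (pawFree_of_not_contains h₁)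
        (diamondFree_of_not_contains h₂) cov hxy hxz hyz
    · exact not_triangle_of_card hV (pawFree_of_not_contains h₁) (pawFree_of_not_contains h₀)
        (diamondFree_of_not_contains h₂) (fun x y hxy => or_left_comm.1 (cov x y hxy)) hxy hxz hyz
  · rintro ⟨c, h₀, h₁, h₂⟩
    exact ⟨c, mt contains_triangle_of_contains_paw h₀, mt contains_triangle_of_contains_paw h₁, h₂⟩

/-- `R(K₃+e, K₃+e, K₄-e) = R(K₃, K₃, K₄-e)`. -/
theorem ramsey_paw_paw_J4_eq_ramsey_K3_K3_J4 :
    Ramsey3 paw paw J4 = Ramsey3 triangle triangle J4 := by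
  simp only [Ramsey3, goodColoring3_paw_iff]
end

section
/- If R(K₃, K₃, K₃, K₃) > 51, then R(K₃+e, K₃+e, K₃+e, K₃+e) = R(K₃, K₃, K₃, K₃). -/
open SimpleGraph

/-- A `(G1, G2, G3, G4; n)`-coloring: a 4-coloring of the edges of `K_n` such that
color `i` contains no subgraph isomorphic to `Gi`. -/
def GoodColoring4 {a b d e : ℕ} (G1 : SimpleGraph (Fin a)) (G2 : SimpleGraph (Fin b))
    (G3 : SimpleGraph (Fin d)) (G4 : SimpleGraph (Fin e)) (n : ℕ) : Prop :=
  ∃ c : Sym2 (Fin n) → Fin 4,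
    ¬ Contains (colorClass c 0) G1 ∧ ¬ Contains (colorClass c 1) G2 ∧
      ¬ Contains (colorClass c 2) G3 ∧ ¬ Contains (colorClass c 3) G4

/-- The 4-color Ramsey number `R(G1, G2, G3, G4)`:
the least `n` such that no `(G1, G2, G3, G4; n)`-coloring exists. -/
noncomputable def Ramsey4 {a b d e : ℕ} (G1 : SimpleGraph (Fin a)) (G2 : SimpleGraph (Fin b))
    (G3 : SimpleGraph (Fin d)) (G4 : SimpleGraph (Fin e)) : ℕ :=
  sInf {n : ℕ | ¬ GoodColoring4 G1 G2 G3 G4 n}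

section EdgeColorings

variable {V C : Type*}

/-- `c` has a monochromatic triangle with all its vertices in `S`. -/
def HasMonoTriangle (c : Sym2 V → C) (S : Finset V) : Prop :=
  ∃ x ∈ S, ∃ y ∈ S, ∃ z ∈ S, x ≠ y ∧ x ≠ z ∧ y ≠ z ∧
    c s(x, y) = c s(x, z) ∧ c s(x, y) = c s(y, z)

/-- `c` has no monochromatic paw. -/
def MonoPawFree (c : Sym2 V → C) : Prop :=
  ∀ x y z w : V, x ≠ y → x ≠ z → y ≠ z → w ≠ x → w ≠ y → w ≠ z →
    c s(x, y) = c s(x, z) → c s(x, y) = c s(y, z) → c s(x, y) ≠ c s(z, w)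

/-- All edges inside `S` get their color from the palette `A`. -/
def UsesColors (c : Sym2 V → C) (S : Finset V) (A : Finset C) : Prop :=
  ∀ x ∈ S, ∀ y ∈ S, x ≠ y → c s(x, y) ∈ A

theorem HasMonoTriangle.mono {c : Sym2 V → C} {S T : Finset V} (h : HasMonoTriangle c T)
    (hTS : T ⊆ S) : HasMonoTriangle c S := by
  obtain ⟨x, hx, y, hy, z, hz, h⟩ := h
  exact ⟨x, hTS hx, y, hTS hy, z, hTS hz, h⟩

variable [DecidableEq V] [DecidableEq C]

/-- If `r - 1` vertices force a monochromatic triangle in `k` colors, written with `m = r - 1`,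
then `(k + 1) * m + 2` vertices force one in `k + 1` colors. -/
theorem hasMonoTriangle_succ {c : Sym2 V → C} {k m : ℕ}
    (ih : ∀ (S : Finset V) (A : Finset C), A.card = k → m < S.card → UsesColors c S A →
      HasMonoTriangle c S)
    (S : Finset V) (A : Finset C) (hA : A.card = k + 1) (hS : (k + 1) * m + 1 < S.card)
    (hc : UsesColors c S A) : HasMonoTriangle c S := by
  obtain ⟨v, hv⟩ : S.Nonempty := Finset.card_pos.mp (by lia)
  have hmaps : ∀ x ∈ S.erase v, c s(v, x) ∈ A := fun x hx =>
    hc v hv x (Finset.mem_of_mem_erase hx) (Finset.ne_of_mem_erase hx).symm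
  obtain ⟨j, hj, hcard⟩ := Finset.exists_lt_card_fiber_of_mul_lt_card_of_maps_to hmaps
    (n := m) (by rw [Finset.card_erase_of_mem hv, hA]; lia)
  set T := (S.erase v).filter fun x => c s(v, x) = j
  have hTS : T ⊆ S := (Finset.filter_subset _ _).trans (Finset.erase_subset _ _)
  by_cases hjT : ∃ x ∈ T, ∃ y ∈ T, x ≠ y ∧ c s(x, y) = j
  · obtain ⟨x, hx, y, hy, hxy, hcol⟩ := hjT
    have hx' := Finset.mem_filter.mp hx
    have hy' := Finset.mem_filter.mp hy
    exact ⟨v, hv, x, hTS hx, y, hTS hy, (Finset.ne_of_mem_erase hx'.1).symm,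
      (Finset.ne_of_mem_erase hy'.1).symm, hxy, hx'.2.trans hy'.2.symm, hx'.2.trans hcol.symm⟩
  · refine (ih T (A.erase j) (by rw [Finset.card_erase_of_mem hj, hA]; rfl) hcard ?_).mono hTS
    intro x hx y hy hxy
    exact Finset.mem_erase.mpr
      ⟨fun h => hjT ⟨x, hx, y, hy, hxy, h⟩, hc x (hTS hx) y (hTS hy) hxy⟩

theorem hasMonoTriangle_of_one_color (c : Sym2 V → C) (S : Finset V) (A : Finset C)
    (hA : A.card = 1) (hS : 2 < S.card) (hc : UsesColors c S A) : HasMonoTriangle c S := by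
  refine hasMonoTriangle_succ (k := 0) (m := 1) ?_ S A hA (by lia) hc
  intro S A hA hS hc
  obtain ⟨x, hx, y, hy, hxy⟩ := Finset.one_lt_card.mp hS
  have := hc x hx y hy hxy
  simp [Finset.card_eq_zero.mp hA] at this

/-- `R(K₃, K₃) ≤ 6`. -/
theorem hasMonoTriangle_of_two_colors (c : Sym2 V → C) (S : Finset V) (A : Finset C)
    (hA : A.card = 2) (hS : 5 < S.card) (hc : UsesColors c S A) : HasMonoTriangle c S :=
  hasMonoTriangle_succ (hasMonoTriangle_of_one_color c) S A hA (by lia) hc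

/-- `R(K₃, K₃, K₃) ≤ 17`. -/
theorem hasMonoTriangle_of_three_colors (c : Sym2 V → C) (S : Finset V) (A : Finset C)
    (hA : A.card = 3) (hS : 16 < S.card) (hc : UsesColors c S A) : HasMonoTriangle c S :=
  hasMonoTriangle_succ (hasMonoTriangle_of_two_colors c) S A hA (by lia) hc

/-- In a coloring without monochromatic paws, a vertex of a monochromatic triangle sends no
further edges of that color, so it has many neighbors in one of the `k` remaining colors `j`,
and `j` does not occur among these neighbors. -/
theorem MonoPawFree.exists_usesColors_erase {c : Sym2 V → C} (hp : MonoPawFree c)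
    {k m : ℕ} (hm : 2 ≤ m) {S : Finset V} {A : Finset C} (hA : A.card = k + 1)
    (hS : k * m + 3 < S.card) (hc : UsesColors c S A) (ht : HasMonoTriangle c S) :
    0 < k ∧ ∃ T ⊆ S, m < T.card ∧ ∃ j ∈ A, UsesColors c T (A.erase j) := by
  obtain ⟨x, hx, y, hy, z, hz, hxy, hxz, hyz, h₁, h₂⟩ := ht
  have hi : c s(x, y) ∈ A := hc x hx y hy hxy
  have hAi : (A.erase (c s(x, y))).card = k := by rw [Finset.card_erase_of_mem hi, hA]; rfl
  have hcard : S.card ≤ (S \ {x, y, z}).card + 3 := by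
    have h₃ := Finset.le_card_sdiff {x, y, z} S
    have h₄ : ({x, y, z} : Finset V).card ≤ 3 := Finset.card_le_three
    lia
  have hmaps : ∀ w ∈ S \ {x, y, z}, c s(z, w) ∈ A.erase (c s(x, y)) := by
    intro w hw
    simp only [Finset.mem_sdiff, Finset.mem_insert, Finset.mem_singleton, not_or] at hw
    obtain ⟨hwS, hwx, hwy, hwz⟩ := hw
    exact Finset.mem_erase.mpr ⟨(hp x y z w hxy hxz hyz hwx hwy hwz h₁ h₂).symm,
      hc z hz w hwS (Ne.symm hwz)⟩
  obtain ⟨j, hj, hT⟩ := Finset.exists_lt_card_fiber_of_mul_lt_card_of_maps_to hmaps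
    (n := m) (by rw [hAi]; lia)
  refine ⟨hAi ▸ Finset.card_pos.mpr ⟨j, hj⟩, _,
    (Finset.filter_subset _ _).trans Finset.sdiff_subset, hT, j, Finset.mem_of_mem_erase hj, ?_⟩
  intro u hu v hv huv
  obtain ⟨w, hw, hwuv⟩ := Finset.exists_mem_notMem_of_card_lt_card
    (s := {u, v}) (Finset.card_le_two.trans_lt (hm.trans_lt hT))
  simp only [Finset.mem_insert, Finset.mem_singleton, not_or] at hwuv
  simp only [Finset.mem_filter, Finset.mem_sdiff, Finset.mem_insert, Finset.mem_singleton,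
    not_or] at hu hv hw
  refine Finset.mem_erase.mpr ⟨fun h => ?_, hc u hu.1.1 v hv.1.1 huv⟩
  refine hp u v z w huv hu.1.2.2.2 hv.1.2.2.2 hwuv.1 hwuv.2 hw.1.2.2.2 ?_ ?_ ?_
  · rw [h, Sym2.eq_swap, hu.2]
  · rw [h, Sym2.eq_swap, hv.2]
  · rw [h, hw.2]

theorem MonoPawFree.card_le_three_of_one_color {c : Sym2 V → C} (hp : MonoPawFree c)
    {S : Finset V} {A : Finset C} (hA : A.card = 1) (hc : UsesColors c S A) : S.card ≤ 3 := by
  by_contra! hS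
  have ht := hasMonoTriangle_of_one_color c S A hA (by lia) hc
  exact absurd (hp.exists_usesColors_erase (k := 0) le_rfl hA (by lia) hc ht).1 (lt_irrefl 0)

/-- `R(K₃ + e, K₃ + e) ≤ 7`. -/
theorem MonoPawFree.card_le_six_of_two_colors {c : Sym2 V → C} (hp : MonoPawFree c)
    {S : Finset V} {A : Finset C} (hA : A.card = 2) (hc : UsesColors c S A) : S.card ≤ 6 := by
  by_contra! hS
  have ht := hasMonoTriangle_of_two_colors c S A hA (by lia) hc
  obtain ⟨-, T, -, hT, j, hj, hcT⟩ :=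
    hp.exists_usesColors_erase (k := 1) (m := 3) (by lia) hA (by lia) hc ht
  have := hp.card_le_three_of_one_color (by rw [Finset.card_erase_of_mem hj, hA]) hcT
  lia

/-- `R(K₃ + e, K₃ + e, K₃ + e) ≤ 17`. -/
theorem MonoPawFree.card_le_sixteen_of_three_colors {c : Sym2 V → C} (hp : MonoPawFree c)
    {S : Finset V} {A : Finset C} (hA : A.card = 3) (hc : UsesColors c S A) : S.card ≤ 16 := by
  by_contra! hS
  have ht := hasMonoTriangle_of_three_colors c S A hA hS hc
  obtain ⟨-, T, -, hT, j, hj, hcT⟩ :=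
    hp.exists_usesColors_erase (k := 2) (m := 6) (by lia) hA (by lia) hc ht
  have := hp.card_le_six_of_two_colors (by rw [Finset.card_erase_of_mem hj, hA]) hcT
  lia

/-- On more than `51` vertices, a 4-coloring without monochromatic paws has no monochromatic
triangle. -/
theorem MonoPawFree.not_hasMonoTriangle_of_four_colors {c : Sym2 V → C} (hp : MonoPawFree c)
    {S : Finset V} {A : Finset C} (hA : A.card = 4) (hc : UsesColors c S A) (hS : 51 < S.card) :
    ¬ HasMonoTriangle c S := by
  intro ht
  obtain ⟨-, T, -, hT, j, hj, hcT⟩ :=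
    hp.exists_usesColors_erase (k := 3) (m := 16) (by lia) hA (by lia) hc ht
  have := hp.card_le_sixteen_of_three_colors (by rw [Finset.card_erase_of_mem hj, hA]) hcT
  lia

end EdgeColorings

theorem colorClass_adj {n m : ℕ} (c : Sym2 (Fin n) → Fin m) (i : Fin m) (x y : Fin n) :
    (colorClass c i).Adj x y ↔ c s(x, y) = i ∧ x ≠ y := by
  simp [colorClass]

theorem monoPawFree_of_not_contains {n m : ℕ} {c : Sym2 (Fin n) → Fin m}
    (h : ∀ i, ¬ Contains (colorClass c i) paw) : MonoPawFree c := by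
  intro x y z w hxy hxz hyz hwx hwy hwz h₁ h₂ h₃
  refine h (c s(x, y)) ⟨![x, y, z, w], ?_, ?_⟩
  · intro a b hab
    fin_cases a <;> fin_cases b <;> simp_all
  · intro a b hab
    rw [colorClass_adj]
    fin_cases a <;> fin_cases b <;> simp_all [paw, Sym2.eq_swap, eq_comm]

theorem hasMonoTriangle_of_contains {n m : ℕ} {c : Sym2 (Fin n) → Fin m} {i : Fin m}
    (h : Contains (colorClass c i) triangle) : HasMonoTriangle c Finset.univ := by
  obtain ⟨f, -, hf⟩ := h
  obtain ⟨h₁, hxy⟩ := (colorClass_adj ..).mp (hf (a := 0) (b := 1) (by simp [triangle]))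
  obtain ⟨h₂, hxz⟩ := (colorClass_adj ..).mp (hf (a := 0) (b := 2) (by simp [triangle]))
  obtain ⟨h₃, hyz⟩ := (colorClass_adj ..).mp (hf (a := 1) (b := 2) (by simp [triangle]))
  exact ⟨f 0, Finset.mem_univ _, f 1, Finset.mem_univ _, f 2, Finset.mem_univ _, hxy, hxz, hyz,
    h₁.trans h₂.symm, h₁.trans h₃.symm⟩

theorem Contains.triangle_of_paw {V : Type*} {G : SimpleGraph V} (h : Contains G paw) :
    Contains G triangle := by
  obtain ⟨f, hf, hadj⟩ := h
  refine ⟨f ∘ Fin.castSucc, hf.comp (Fin.castSucc_injective 3), fun a b hab => hadj ?_⟩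
  fin_cases a <;> fin_cases b <;> simp_all [paw, triangle]

theorem goodColoring4_self_iff {a n : ℕ} (G : SimpleGraph (Fin a)) :
    GoodColoring4 G G G G n ↔
      ∃ c : Sym2 (Fin n) → Fin 4, ∀ i, ¬ Contains (colorClass c i) G := by
  simp [GoodColoring4, Fin.forall_fin_succ]

theorem goodColoring4_paw_of_triangle {n : ℕ}
    (h : GoodColoring4 triangle triangle triangle triangle n) :
    GoodColoring4 paw paw paw paw n := by
  rw [goodColoring4_self_iff] at h ⊢
  exact h.imp fun c hc i hi => hc i hi.triangle_of_paw

theorem goodColoring4_triangle_of_paw {n : ℕ} (hn : 51 < n)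
    (h : GoodColoring4 paw paw paw paw n) :
    GoodColoring4 triangle triangle triangle triangle n := by
  rw [goodColoring4_self_iff] at h ⊢
  obtain ⟨c, hc⟩ := h
  exact ⟨c, fun i hi => (monoPawFree_of_not_contains hc).not_hasMonoTriangle_of_four_colors
    (A := Finset.univ) (by simp) (fun _ _ _ _ _ => Finset.mem_univ _) (by simpa using hn)
    (hasMonoTriangle_of_contains hi)⟩

/-- If `R(K₃, K₃, K₃, K₃) > 51`, then `R(K₃+e, K₃+e, K₃+e, K₃+e) = R(K₃, K₃, K₃, K₃)`. -/
theorem ramsey4_paw_of_ramsey4_K3_gt_51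
    (h : 51 < Ramsey4 triangle triangle triangle triangle) :
    Ramsey4 paw paw paw paw = Ramsey4 triangle triangle triangle triangle := by
  have hmem : ¬ GoodColoring4 triangle triangle triangle triangle
      (Ramsey4 triangle triangle triangle triangle) :=
    Nat.sInf_mem (Nat.nonempty_of_pos_sInf (lt_of_le_of_lt (Nat.zero_le _) h))
  have hmem' : ¬ GoodColoring4 paw paw paw paw (Ramsey4 triangle triangle triangle triangle) :=
    fun hp => hmem (goodColoring4_triangle_of_paw h hp)
  refine le_antisymm (Nat.sInf_le hmem') (le_csInf ⟨_, hmem'⟩ fun n hn => Nat.sInf_le ?_)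
  exact fun ht => hn (goodColoring4_paw_of_triangle ht)
end

section
/- Every (K₃+e, K₄−e; 6)-good graph contains a cycle C₆ on 6 vertices as a subgraph or is isomorphic to 2K₃, the disjoint union of two triangles. -/
open SimpleGraph

/-- The cycle on 6 vertices. -/
def C6 : SimpleGraph (Fin 6) :=
  SimpleGraph.fromEdgeSet {s(0, 1), s(1, 2), s(2, 3), s(3, 4), s(4, 5), s(5, 0)}

/-- `2K₃`: the disjoint union of two triangles, on vertices `{0,1,2}` and `{3,4,5}`. -/
def twoK3 : SimpleGraph (Fin 6) :=
  SimpleGraph.fromEdgeSet {s(0, 1), s(0, 2), s(1, 2), s(3, 4), s(3, 5), s(4, 5)}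

theorem Contains.paw_of_adj {V : Type*} {G : SimpleGraph V} {a b c d : V}
    (hab : G.Adj a b) (hac : G.Adj a c) (hbc : G.Adj b c) (hcd : G.Adj c d)
    (had : a ≠ d) (hbd : b ≠ d) : Contains G paw := by
  refine ⟨![a, b, c, d], ?_, ?_⟩
  · have := hab.ne
    have := hac.ne
    have := hbc.ne
    have := hcd.ne
    intro i j
    fin_cases i <;> fin_cases j <;> simp_all [eq_comm]
  · intro i j
    fin_cases i <;> fin_cases j <;> simp [paw, *, G.adj_comm]

theorem Contains.J4_of_adj {V : Type*} {G : SimpleGraph V} {a b c d : V} (hab : a ≠ b)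
    (hac : G.Adj a c) (had : G.Adj a d) (hbc : G.Adj b c) (hbd : G.Adj b d) (hcd : G.Adj c d) :
    Contains G J4 := by
  refine ⟨![a, b, c, d], ?_, ?_⟩
  · have := hac.ne
    have := had.ne
    have := hbc.ne
    have := hbd.ne
    have := hcd.ne
    intro i j
    fin_cases i <;> fin_cases j <;> simp_all [eq_comm]
  · have := hac.symm
    have := had.symm
    have := hbc.symm
    have := hbd.symm
    have := hcd.symm
    intro i j
    fin_cases i <;> fin_cases j <;> simp [J4, *]

theorem Contains.C6_of_adj {V : Type*} {G : SimpleGraph V} {f : Fin 6 → V}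
    (hf : Function.Injective f) (h01 : G.Adj (f 0) (f 1)) (h12 : G.Adj (f 1) (f 2))
    (h23 : G.Adj (f 2) (f 3)) (h34 : G.Adj (f 3) (f 4)) (h45 : G.Adj (f 4) (f 5))
    (h50 : G.Adj (f 5) (f 0)) : Contains G C6 := by
  refine ⟨f, hf, ?_⟩
  have := h01.symm
  have := h12.symm
  have := h23.symm
  have := h34.symm
  have := h45.symm
  have := h50.symm
  intro i j
  fin_cases i <;> fin_cases j <;> simp [C6, *]

theorem adj_of_not_contains_J4 {V : Type*} {G : SimpleGraph V} (h : ¬ Contains Gᶜ J4)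
    {a b c d : V} (hab : a ≠ b) (hac : a ≠ c) (had : a ≠ d) (hbc : b ≠ c) (hbd : b ≠ d)
    (hcd : c ≠ d) : G.Adj a c ∨ G.Adj a d ∨ G.Adj b c ∨ G.Adj b d ∨ G.Adj c d := by
  by_contra! hn
  refine h (Contains.J4_of_adj (a := a) (b := b) (c := c) (d := d) hab ?_ ?_ ?_ ?_ ?_) <;>
    simp [compl_adj, *]

/-- Three distinct vertices of `Fin 6` extend to an enumeration of `Fin 6`. -/
theorem exists_injective_extension {a b c : Fin 6} (hab : a ≠ b) (hac : a ≠ c) (hbc : b ≠ c) :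
    ∃ f : Fin 6 → Fin 6, Function.Injective f ∧ f 0 = a ∧ f 1 = b ∧ f 2 = c := by
  have h : ({a, b, c}ᶜ : Finset (Fin 6)).card = 3 := by
    rw [Finset.card_compl, Finset.card_eq_three.2 ⟨a, b, c, hab, hac, hbc, rfl⟩, Fintype.card_fin]
  obtain ⟨d, e, f, hde, hdf, hef, hs⟩ := Finset.card_eq_three.1 h
  have hm : ∀ x, x ∈ ({d, e, f} : Finset (Fin 6)) → x ≠ a ∧ x ≠ b ∧ x ≠ c := by
    intro x hx
    rw [← hs] at hx
    simpa using hx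
  have hd := hm d (by simp)
  have he := hm e (by simp)
  have hf := hm f (by simp)
  refine ⟨![a, b, c, d, e, f], ?_, rfl, rfl, rfl⟩
  intro i j
  fin_cases i <;> fin_cases j <;> simp <;> grind

/-- The bound `R(3, 3) ≤ 6`. -/
theorem exists_triangle_or_compl_triangle (G : SimpleGraph (Fin 6)) :
    (∃ a b c, G.Adj a b ∧ G.Adj a c ∧ G.Adj b c) ∨
      ∃ a b c, Gᶜ.Adj a b ∧ Gᶜ.Adj a c ∧ Gᶜ.Adj b c := by
  classical
  have hdeg : 2 < G.degree 0 ∨ 2 < Gᶜ.degree 0 := by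
    have := G.degree_compl 0
    rw [Fintype.card_fin] at this
    omega
  rcases hdeg with h | h <;>
  · obtain ⟨a, ha, b, hb, c, hc, hab, hac, hbc⟩ := Finset.two_lt_card.1 h
    rw [mem_neighborFinset] at ha hb hc
    by_contra! hn
    obtain ⟨hG, hGc⟩ := hn
    have g := hG a b c
    have gab := hG 0 a b
    have gac := hG 0 a c
    have gbc := hG 0 b c
    have k := hGc a b c
    have kab := hGc 0 a b
    have kac := hGc 0 a c
    have kbc := hGc 0 b c
    clear hG hGc
    grind [compl_adj]

theorem nonempty_iso_twoK3_of_triangle {G : SimpleGraph (Fin 6)} (h1 : ¬ Contains G paw)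
    (h2 : ¬ Contains Gᶜ J4) {a b c : Fin 6} (hab : G.Adj a b) (hac : G.Adj a c)
    (hbc : G.Adj b c) : Nonempty (G ≃g twoK3) := by
  obtain ⟨f, hf, rfl, rfl, rfl⟩ := exists_injective_extension hab.ne hac.ne hbc.ne
  have hne : ∀ {i j}, i ≠ j → f i ≠ f j := hf.ne
  have out : ∀ i, 0 ≠ i → 1 ≠ i → 2 ≠ i →
      ¬ G.Adj (f 0) (f i) ∧ ¬ G.Adj (f 1) (f i) ∧ ¬ G.Adj (f 2) (f i) := fun i n0 n1 n2 =>
    ⟨fun h => h1 (.paw_of_adj hbc hab.symm hac.symm h (hne n1) (hne n2)),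
      fun h => h1 (.paw_of_adj hac hab hbc.symm h (hne n0) (hne n2)),
      fun h => h1 (.paw_of_adj hab hac hbc h (hne n0) (hne n1))⟩
  have o3 := out 3 (by decide) (by decide) (by decide)
  have o4 := out 4 (by decide) (by decide) (by decide)
  have o5 := out 5 (by decide) (by decide) (by decide)
  have inside : ∀ i j, 0 ≠ i → 1 ≠ i → 2 ≠ i → 0 ≠ j → 1 ≠ j → 2 ≠ j → i ≠ j →
      G.Adj (f i) (f j) := by
    intro i j i0 i1 i2 j0 j1 j2 hij
    have := adj_of_not_contains_J4 h2 hab.ne (hne i0) (hne j0) (hne i1) (hne j1) (hne hij)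
    have := out i i0 i1 i2
    have := out j j0 j1 j2
    tauto
  have h34 : G.Adj (f 3) (f 4) := by apply inside <;> decide
  have h35 : G.Adj (f 3) (f 5) := by apply inside <;> decide
  have h45 : G.Adj (f 4) (f 5) := by apply inside <;> decide
  refine ⟨Iso.symm ⟨Equiv.ofBijective f (Finite.injective_iff_bijective.1 hf), ?_⟩⟩
  intro i j
  have hc := G.adj_comm
  fin_cases i <;> fin_cases j <;> simp [twoK3] <;> grind

theorem contains_C6_of_compl_triangle {G : SimpleGraph (Fin 6)}
    (hG : ∀ a b c, G.Adj a b → G.Adj a c → ¬ G.Adj b c) (h2 : ¬ Contains Gᶜ J4) {a b c : Fin 6}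
    (hab : Gᶜ.Adj a b) (hac : Gᶜ.Adj a c) (hbc : Gᶜ.Adj b c) : Contains G C6 := by
  obtain ⟨f, hf, rfl, rfl, rfl⟩ := exists_injective_extension hab.ne hac.ne hbc.ne
  have hne : ∀ {i j}, i ≠ j → f i ≠ f j := hf.ne
  have two : ∀ {p q r i}, Gᶜ.Adj (f p) (f q) → Gᶜ.Adj (f p) (f r) → Gᶜ.Adj (f q) (f r) →
      p ≠ i → q ≠ i → r ≠ i → G.Adj (f p) (f i) ∨ G.Adj (f q) (f i) := by
    intro p q r i hpq hpr hqr hpi hqi hri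
    have := adj_of_not_contains_J4 h2 (hne hri) hpr.ne' hqr.ne' (hne hpi.symm) (hne hqi.symm) hpq.ne
    simp only [compl_adj, G.adj_comm] at *
    grind
  have left : ∀ i, 0 ≠ i → 1 ≠ i → 2 ≠ i → (G.Adj (f 0) (f i) ∨ G.Adj (f 1) (f i)) ∧
      (G.Adj (f 0) (f i) ∨ G.Adj (f 2) (f i)) ∧ (G.Adj (f 1) (f i) ∨ G.Adj (f 2) (f i)) :=
    fun i h0 h1 h2 => ⟨two hab hac hbc h0 h1 h2, two hac hab hbc.symm h0 h2 h1,
      two hbc hab.symm hac.symm h1 h2 h0⟩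
  have l3 := left 3 (by decide) (by decide) (by decide)
  have l4 := left 4 (by decide) (by decide) (by decide)
  have l5 := left 5 (by decide) (by decide) (by decide)
  have indep : ∀ i j, 0 ≠ i → 1 ≠ i → 2 ≠ i → 0 ≠ j → 1 ≠ j → 2 ≠ j → i ≠ j →
      Gᶜ.Adj (f i) (f j) := by
    intro i j i0 i1 i2 j0 j1 j2 hij
    have hi := left i i0 i1 i2
    have hj := left j j0 j1 j2
    have g0 := hG (f 0) (f i) (f j)
    have g1 := hG (f 1) (f i) (f j)
    have g2 := hG (f 2) (f i) (f j)
    refine (compl_adj ..).2 ⟨hne hij, ?_⟩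
    clear * - hi hj g0 g1 g2
    grind
  have h34 : Gᶜ.Adj (f 3) (f 4) := by apply indep <;> decide
  have h35 : Gᶜ.Adj (f 3) (f 5) := by apply indep <;> decide
  have h45 : Gᶜ.Adj (f 4) (f 5) := by apply indep <;> decide
  have right : ∀ i, 3 ≠ i → 4 ≠ i → 5 ≠ i → (G.Adj (f 3) (f i) ∨ G.Adj (f 4) (f i)) ∧
      (G.Adj (f 3) (f i) ∨ G.Adj (f 5) (f i)) ∧ (G.Adj (f 4) (f i) ∨ G.Adj (f 5) (f i)) :=
    fun i h3 h4 h5 => ⟨two h34 h35 h45 h3 h4 h5, two h35 h34 h45.symm h3 h5 h4,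
      two h45 h34.symm h35.symm h4 h5 h3⟩
  have r0 := right 0 (by decide) (by decide) (by decide)
  have r1 := right 1 (by decide) (by decide) (by decide)
  have r2 := right 2 (by decide) (by decide) (by decide)
  rw [G.adj_comm (f 3), G.adj_comm (f 4), G.adj_comm (f 5)] at r0 r1 r2
  have hexagon : ∀ x y z : Fin 6, Function.Injective ![0, x, 1, y, 2, z] →
      G.Adj (f 0) (f x) → G.Adj (f 1) (f x) → G.Adj (f 1) (f y) → G.Adj (f 2) (f y) →
      G.Adj (f 2) (f z) → G.Adj (f 0) (f z) → Contains G C6 :=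
    fun x y z hinj h0x h1x h1y h2y h2z h0z =>
      .C6_of_adj (f := f ∘ ![0, x, 1, y, 2, z]) (hf.comp hinj) h0x h1x.symm h1y h2y.symm h2z h0z.symm
  have c345 := hexagon 3 4 5 (by decide)
  have c354 := hexagon 3 5 4 (by decide)
  have c435 := hexagon 4 3 5 (by decide)
  have c453 := hexagon 4 5 3 (by decide)
  have c534 := hexagon 5 3 4 (by decide)
  have c543 := hexagon 5 4 3 (by decide)
  clear * - l3 l4 l5 r0 r1 r2 c345 c354 c435 c453 c534 c543
  grind

/-- Every `(K₃+e, K₄-e; 6)`-good graph contains a `C₆` or is isomorphic to `2K₃`. -/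
theorem good_graph_contains_C6_or_twoK3 (G : SimpleGraph (Fin 6))
    (h1 : ¬ Contains G paw) (h2 : ¬ Contains Gᶜ J4) :
    Contains G C6 ∨ Nonempty (G ≃g twoK3) := by
  by_cases hG : ∃ a b c, G.Adj a b ∧ G.Adj a c ∧ G.Adj b c
  · obtain ⟨a, b, c, hab, hac, hbc⟩ := hG
    exact .inr (nonempty_iso_twoK3_of_triangle h1 h2 hab hac hbc)
  · obtain ⟨a, b, c, hab, hac, hbc⟩ := (exists_triangle_or_compl_triangle G).resolve_left hG
    exact .inl (contains_C6_of_compl_triangle (fun x y z hxy hxz hyz => hG ⟨x, y, z, hxy, hxz, hyz⟩)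
      h2 hab hac hbc)
end

section
/- J₇ → (K₃+e, K₄−e). That is, for every partition of the edges of J₇ = K₇ minus one edge into two color classes, the first class contains a subgraph isomorphic to the paw graph K₃+e or the second class contains a subgraph isomorphic to K₄−e. -/
open SimpleGraph

/-- `J₇ = K₇ - e`, the complete graph on 7 vertices with one edge deleted. -/
def J7 : SimpleGraph (Fin 7) := (⊤ : SimpleGraph (Fin 7)).deleteEdges {s(0, 1)}

/-- Every bit of `m` indexes a true statement. -/
def BitsHold (P : ℕ → Prop) (m : ℕ) : Prop := ∀ i, m.testBit i → P i

theorem BitsHold.or {P : ℕ → Prop} {m n : ℕ} (hm : BitsHold P m) (hn : BitsHold P n) :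
    BitsHold P (m ||| n) := fun i hi => by
  rw [Nat.testBit_or, Bool.or_eq_true] at hi
  exact hi.elim (hm i) (hn i)

theorem BitsHold.of_land_eq {P : ℕ → Prop} {m n : ℕ} (hn : BitsHold P n)
    (h : Nat.beq (Nat.land n m) m = true) : BitsHold P m := fun i hi => by
  have h' : n &&& m = m := Nat.eq_of_beq_eq_true h
  rw [← h', Nat.testBit_and, Bool.and_eq_true] at hi
  exact hn i hi.1

theorem bitsHold_two_pow {P : ℕ → Prop} {x : ℕ} (hx : P x) : BitsHold P (2 ^ x) := fun i hi => by
  rw [Nat.testBit_two_pow] at hi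
  exact of_decide_eq_true hi ▸ hx

/-- Whether one of the masks `ms` is contained in `A`. The explicit recursor makes this cheap to
evaluate in the kernel. -/
noncomputable def coversAny (A : ℕ) (ms : List ℕ) : Bool :=
  List.rec false (fun m _ ih => bif Nat.beq (Nat.land A m) m then true else ih) ms

theorem exists_of_coversAny {A : ℕ} {ms : List ℕ} (h : coversAny A ms = true) :
    ∃ m ∈ ms, Nat.beq (Nat.land A m) m = true := by
  induction ms with
  | nil => exact absurd h (by simp [coversAny])
  | cons m ms ih =>
    change (bif Nat.beq (Nat.land A m) m then true else coversAny A ms) = true at h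
    rw [Bool.cond_true_left, Bool.or_eq_true] at h
    obtain h | h := h
    · exact ⟨m, List.mem_cons_self, h⟩
    · obtain ⟨m', hm', h⟩ := ih h
      exact ⟨m', List.mem_cons_of_mem _ hm', h⟩

/-- Backtracking search. Each step of the schedule offers two alternatives `x` and `y`, each with
a list of masks; a branch is closed once one of these masks is contained in the set `A` of the
alternatives chosen so far. -/
noncomputable def closes : List ((ℕ × List ℕ) × (ℕ × List ℕ)) → ℕ → Bool
  | [], _ => false
  | ((x, ms), (y, ns)) :: steps, A =>
    (coversAny (Nat.lor A (Nat.pow 2 x)) ms || closes steps (Nat.lor A (Nat.pow 2 x))) &&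
      (coversAny (Nat.lor A (Nat.pow 2 y)) ns || closes steps (Nat.lor A (Nat.pow 2 y)))

theorem exists_bitsHold_of_closes {P Q : ℕ → Prop}
    {steps : List ((ℕ × List ℕ) × (ℕ × List ℕ))} {A : ℕ}
    (hP : ∀ s ∈ steps, P s.1.1 ∨ P s.2.1)
    (hQ : ∀ s ∈ steps, (∀ m ∈ s.1.2, Q m) ∧ ∀ m ∈ s.2.2, Q m)
    (hA : BitsHold P A) (h : closes steps A = true) : ∃ m, Q m ∧ BitsHold P m := by
  induction steps generalizing A with
  | nil => simp [closes] at h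
  | cons s steps ih =>
    obtain ⟨⟨x, ms⟩, y, ns⟩ := s
    simp only [closes, Bool.and_eq_true, Bool.or_eq_true] at h
    rw [List.forall_mem_cons] at hP hQ
    have branch {z : ℕ} {ls : List ℕ} (hz : P z) (hls : ∀ m ∈ ls, Q m)
        (h : coversAny (Nat.lor A (Nat.pow 2 z)) ls = true ∨
          closes steps (Nat.lor A (Nat.pow 2 z)) = true) : ∃ m, Q m ∧ BitsHold P m := by
      have hA' : BitsHold P (Nat.lor A (Nat.pow 2 z)) := hA.or (bitsHold_two_pow hz)
      obtain h | h := h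
      · obtain ⟨m, hm, hmA⟩ := exists_of_coversAny h
        exact ⟨m, hls m hm, hA'.of_land_eq hmA⟩
      · exact ih hP.2 hQ.2 hA' h
    exact hP.1.elim (fun hx => branch hx hQ.1.1 h.1) (fun hy => branch hy hQ.1.2 h.2)

/-- The index of the edge `ab`, where `a` and `b` are less than `7`. -/
def edgeIndex (a b : ℕ) : ℕ := bif Nat.blt a b then 7 * a + b else 7 * b + a

/-- The edge with a given index. Indices from `49` on name the same edges again, so that the
statement that the edge has color `i` can be given the index shifted by `49 * i`. -/
def indexEdge (n : ℕ) : Sym2 (Fin 7) := s(Fin.ofNat 7 (n / 7), Fin.ofNat 7 n)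

theorem indexEdge_add : ∀ n < 49, indexEdge (n + 49) = indexEdge n := by decide

theorem indexEdge_edgeIndex : ∀ (i : Fin 2) (a b : Fin 7),
    indexEdge (edgeIndex a b + 49 * i) = s(a, b) ∧ (edgeIndex a b + 49 * i) / 49 = i := by
  decide

theorem J7_adj_of_edgeIndex_ne_one : ∀ a b : Fin 7, a ≠ b → edgeIndex a b ≠ 1 → J7.Adj a b := by
  simp only [J7, deleteEdges_adj, top_adj, Set.mem_singleton_iff]
  decide

theorem nat_beq_eq_false_iff {a b : ℕ} : Nat.beq a b = false ↔ a ≠ b := by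
  rw [← Bool.not_eq_true, Nat.beq_eq]

/-- The quadruples of distinct numbers less than `7`, the first less than the second. -/
def quadruples : List (ℕ × ℕ × ℕ × ℕ) :=
  (List.range 7).flatMap fun a =>
    ((List.range 7).filter fun b => Nat.blt a b).flatMap fun b =>
      ((List.range 7).filter fun c => !(Nat.beq a c || Nat.beq b c)).flatMap fun c =>
        ((List.range 7).filter fun d => !(Nat.beq a d || Nat.beq b d || Nat.beq c d)).map
          fun d => (a, b, c, d)

theorem exists_injective_of_mem_quadruples {a b c d : ℕ} (h : (a, b, c, d) ∈ quadruples) :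
    ∃ g : Fin 4 → Fin 7, Function.Injective g ∧
      (g 0).val = a ∧ (g 1).val = b ∧ (g 2).val = c ∧ (g 3).val = d := by
  simp only [quadruples, List.mem_flatMap, List.mem_map, List.mem_filter, List.mem_range,
    Bool.not_eq_true', Bool.or_eq_false_iff, Nat.blt_eq, nat_beq_eq_false_iff,
    Prod.mk.injEq] at h
  obtain ⟨a, ha, b, ⟨hb, hab⟩, c, ⟨hc, hac, hbc⟩, d, ⟨hd, ⟨had, hbd⟩, hcd⟩, rfl, rfl, rfl, rfl⟩ := h
  refine ⟨![⟨a, ha⟩, ⟨b, hb⟩, ⟨c, hc⟩, ⟨d, hd⟩], fun i j hij => ?_, rfl, rfl, rfl, rfl⟩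
  fin_cases i <;> fin_cases j <;> simp at hij ⊢ <;> omega

/-- The mask saying that the listed edges have color `i`. -/
def colorMask (i : ℕ) (es : List (ℕ × ℕ)) : ℕ :=
  es.foldr (fun e m => Nat.lor (Nat.pow 2 (edgeIndex e.1 e.2 + 49 * i)) m) 0

theorem testBit_colorMask {es : List (ℕ × ℕ)} {i : ℕ} {e : ℕ × ℕ} (he : e ∈ es) :
    (colorMask i es).testBit (edgeIndex e.1 e.2 + 49 * i) := by
  induction es with
  | nil => simp at he
  | cons e' es ih =>
    change (2 ^ _ ||| colorMask i es).testBit _ = true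
    rw [Nat.testBit_or, Bool.or_eq_true]
    obtain rfl | he := List.mem_cons.1 he
    · exact .inl Nat.testBit_two_pow_self
    · exact .inr (ih he)

/-- The edges of the paw on the vertices `a`, `b`, `c`, `d`. -/
def pawEdges : ℕ × ℕ × ℕ × ℕ → List (ℕ × ℕ)
  | (a, b, c, d) => [(a, b), (a, c), (b, c), (c, d)]

/-- The edges of `J₄` on the vertices `a`, `b`, `c`, `d`. -/
def J4Edges : ℕ × ℕ × ℕ × ℕ → List (ℕ × ℕ)
  | (a, b, c, d) => [(a, c), (a, d), (b, c), (b, d), (c, d)]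

/-- The masks of the copies in `J₇`, in color `i`, of the graph with the given edges. -/
def copyMasks (es : ℕ × ℕ × ℕ × ℕ → List (ℕ × ℕ)) (i : ℕ) : List ℕ :=
  ((quadruples.map es).filter fun l => l.all fun e => !Nat.beq (edgeIndex e.1 e.2) 1).map
    (colorMask i)

theorem contains_of_mem_copyMasks {c : Sym2 (Fin 7) → Fin 2} {i : Fin 2} {H : SimpleGraph (Fin 4)}
    {es : ℕ × ℕ × ℕ × ℕ → List (ℕ × ℕ)} {m : ℕ}
    (hH : ∀ g : Fin 4 → ℕ, ∀ a b, H.Adj a b →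
      (g a, g b) ∈ es (g 0, g 1, g 2, g 3) ∨ (g b, g a) ∈ es (g 0, g 1, g 2, g 3))
    (hm : m ∈ copyMasks es i) (hc : BitsHold (fun n => (c (indexEdge n)).val = n / 49) m) :
    Contains (SimpleGraph.fromEdgeSet {e | e ∈ J7.edgeSet ∧ c e = i}) H := by
  simp only [copyMasks, List.mem_map, List.mem_filter, List.all_eq_true, Bool.not_eq_true',
    nat_beq_eq_false_iff] at hm
  obtain ⟨_, ⟨⟨q, hq, rfl⟩, hne⟩, rfl⟩ := hm
  obtain ⟨g, hinj, h⟩ := exists_injective_of_mem_quadruples hq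
  obtain rfl : ((g 0).val, (g 1).val, (g 2).val, (g 3).val) = q := by
    rw [h.1, h.2.1, h.2.2.1, h.2.2.2]
  have key (a b : Fin 4) (hab : g a ≠ g b)
      (he : ((g a).val, (g b).val) ∈ es ((g 0).val, (g 1).val, (g 2).val, (g 3).val)) :
      s(g a, g b) ∈ {e | e ∈ J7.edgeSet ∧ c e = i} := by
    refine ⟨J7_adj_of_edgeIndex_ne_one _ _ hab (hne _ he), Fin.ext ?_⟩
    have : _ = _ / 49 := hc _ (testBit_colorMask he)
    rwa [(indexEdge_edgeIndex i _ _).1, (indexEdge_edgeIndex i _ _).2] at this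
  refine ⟨g, hinj, fun a b hab => ?_⟩
  have hgab : g a ≠ g b := hinj.ne hab.ne
  rw [fromEdgeSet_adj]
  refine ⟨?_, hgab⟩
  obtain h | h := hH (fun j => (g j).val) a b hab
  · exact key _ _ hgab h
  · rw [Sym2.eq_swap]
    exact key _ _ hgab.symm h

/-- The indices of the edges of `J₇`, in decreasing order. -/
def J7Indices : List ℕ :=
  (List.range 49).reverse.filter fun n => Nat.blt (n / 7) (n % 7) && !Nat.beq n 1

/-- The masks whose lowest bit is `n`. -/
def withLowestBit (n : ℕ) (ms : List ℕ) : List ℕ :=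
  ms.filter fun m => Nat.beq (m % Nat.pow 2 (n + 1)) (Nat.pow 2 n)

/-- Color the edges of `J₇` in decreasing order, looking at each copy of the paw and of `J₄`
when its last edge is colored. -/
def schedule : List ((ℕ × List ℕ) × (ℕ × List ℕ)) :=
  J7Indices.map fun n =>
    ((n, withLowestBit n (copyMasks pawEdges 0)),
      (n + 49, withLowestBit (n + 49) (copyMasks J4Edges 1)))

theorem closes_schedule : closes schedule 0 = true := by
  decide +kernel

/-- `J₇ → (K₃+e, K₄-e)`: every 2-coloring of the edges of `J₇` yields a paw in the
first color or a `K₄ - e` in the second color. -/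
theorem J7_arrows_paw_J4 :
    ∀ c : Sym2 (Fin 7) → Fin 2,
      Contains (SimpleGraph.fromEdgeSet {e | e ∈ J7.edgeSet ∧ c e = 0}) paw ∨
        Contains (SimpleGraph.fromEdgeSet {e | e ∈ J7.edgeSet ∧ c e = 1}) J4 := by
  intro c
  have hP : ∀ s ∈ schedule, (c (indexEdge s.1.1)).val = s.1.1 / 49 ∨
      (c (indexEdge s.2.1)).val = s.2.1 / 49 := by
    simp only [schedule, J7Indices, List.forall_mem_map, List.mem_filter, List.mem_reverse,
      List.mem_range]
    intro n hn
    rw [indexEdge_add n hn.1]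
    omega
  have hQ : ∀ s ∈ schedule,
      (∀ m ∈ s.1.2, m ∈ copyMasks pawEdges 0 ∨ m ∈ copyMasks J4Edges 1) ∧
        ∀ m ∈ s.2.2, m ∈ copyMasks pawEdges 0 ∨ m ∈ copyMasks J4Edges 1 := by
    simp only [schedule, withLowestBit, List.forall_mem_map, List.mem_filter]
    exact fun n _ => ⟨fun m hm => .inl hm.1, fun m hm => .inr hm.1⟩
  obtain ⟨m, hm, hc⟩ := exists_bitsHold_of_closes
    (P := fun n => (c (indexEdge n)).val = n / 49)
    (Q := fun m => m ∈ copyMasks pawEdges 0 ∨ m ∈ copyMasks J4Edges 1)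
    hP hQ (fun i hi => by simp at hi) closes_schedule
  obtain hm | hm := hm
  · refine .inl (contains_of_mem_copyMasks (i := 0) (fun g a b hab => ?_) hm hc)
    fin_cases a <;> fin_cases b <;> simp [paw, pawEdges] at hab ⊢
  · refine .inr (contains_of_mem_copyMasks (i := 1) (fun g a b hab => ?_) hm hc)
    fin_cases a <;> fin_cases b <;> simp [J4, J4Edges] at hab ⊢
end
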